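/- Let f be a nonnegative bounded measurable function on ℝ^{d−1}×(0,∞) with compact support. Then the heat potential G(f)(x,t) = (1/p)·∫_{ℝ^{d−1}×(0,∞)} Φ(x−y, t−r)·f(y,r) dy dr is a supercaloric function on ℝ^{d−1}×ℝ. -/

import Mathlib

open MeasureTheory Filter Real

noncomputable section

/-- Space-time: `ℝ^{d-1} × ℝ`. -/
abbrev Pt (d : ℕ) := (Fin (d-1) → ℝ) × ℝ

/-- The constant β = p(d−1)/(2(1−p)). -/
def heatBeta (d : ℕ) (p : ℝ) : ℝ := p * ((d : ℝ) - 1) / (2 * (1 - p))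

/-- The fundamental solution Φ of the drifted heat equation. -/
def heatPhi (d : ℕ) (p : ℝ) (x : Fin (d-1) → ℝ) (t : ℝ) : ℝ :=
  if 0 < t then
    (heatBeta d p / (π * t)) ^ (((d : ℝ) - 1) / 2) *
      Real.exp (-(heatBeta d p) * (∑ i, (x i) ^ 2) / t)
  else 0

/-- The heat ball `E(x,t;r)`. -/
def heatBallE (d : ℕ) (p : ℝ) (x : Fin (d-1) → ℝ) (t r : ℝ) : Set (Pt d) :=
  {z | z.2 ≤ t ∧ r ^ (-((d : ℝ) - 1)) ≤ heatPhi d p (fun i => x i - z.1 i) (t - z.2)}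

/-- The parabolic mean value operator `𝔄_r`. -/
def meanOp (d : ℕ) (p : ℝ) (f : Pt d → ℝ) (x : Fin (d-1) → ℝ) (t r : ℝ) : ℝ :=
  (heatBeta d p / (4 * r ^ ((d : ℝ) - 1))) *
    ∫ z in heatBallE d p x t r, f z * (∑ i, (x i - z.1 i) ^ 2) / (t - z.2) ^ 2

/-- A measurable function is supercaloric if it dominates its parabolic means. -/
def Supercaloric (d : ℕ) (p : ℝ) (f : Pt d → ℝ) : Prop :=
  Measurable f ∧ ∀ x t, ∀ r > 0, meanOp d p f x t r ≤ f (x, t)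

/-- The obstacle function γ. -/
def gammaFn (d : ℕ) (p : ℝ) (z : Pt d) : ℝ :=
  z.2 - (∑ i, (z.1 i) ^ 2) -
    (1 / p) * ((heatBeta d p / (π * z.2)) ^ (((d : ℝ) - 1) / 2) *
      Real.exp (-(heatBeta d p) * (∑ i, (z.1 i) ^ 2) / z.2))

/-- The pointwise infimum `s` of all supercaloric majorants of γ (on the upper half-space). -/
def sMaj (d : ℕ) (p : ℝ) (z : Pt d) : ℝ :=
  sInf {v | ∃ f : Pt d → ℝ, Supercaloric d p f ∧
    (∀ w : Pt d, 0 < w.2 → gammaFn d p w ≤ f w) ∧ v = f z}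

/-- The limiting odometer u = s − γ. -/
def uFn (d : ℕ) (p : ℝ) (z : Pt d) : ℝ := sMaj d p z - gammaFn d p z

/-- The non-coincidence set D = {u > 0} ⊆ ℝ^{d-1} × (0,∞). -/
def Dset (d : ℕ) (p : ℝ) : Set (Pt d) := {z | 0 < z.2 ∧ 0 < uFn d p z}

/-- Spatial Laplacian of φ at z. -/
def spaceLaplacian (d : ℕ) (φ : Pt d → ℝ) (z : Pt d) : ℝ :=
  ∑ i : Fin (d-1),
    fderiv ℝ (fun w => fderiv ℝ φ w ((Pi.single i 1 : Fin (d-1) → ℝ), (0:ℝ))) z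
      ((Pi.single i 1 : Fin (d-1) → ℝ), (0:ℝ))

/-- Time derivative of φ at z. -/
def timeDeriv (d : ℕ) (φ : Pt d → ℝ) (z : Pt d) : ℝ :=
  fderiv ℝ φ z ((0 : Fin (d-1) → ℝ), (1:ℝ))

end
/-- The continuous heat potential `G(f)(x,t) = (1/p)∫ Φ(x−y,t−r) f(y,r) dy dr`. -/
noncomputable def Gpot (d : ℕ) (p : ℝ) (f : Pt d → ℝ) (z : Pt d) : ℝ :=
  (1 / p) * ∫ w in {w : Pt d | 0 < w.2},
    heatPhi d p (fun i => z.1 i - w.1 i) (z.2 - w.2) * f w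

/-- The Gaussian kernel `(b/(πs))^{n/2} exp(-b|y|²/s)` on `ℝⁿ`, for `s > 0`. -/
noncomputable def gaussKernel {n : ℕ} (b : ℝ) (y : Fin n → ℝ) (s : ℝ) : ℝ :=
  (b / (π * s)) ^ ((n : ℝ) / 2) * Real.exp (-b * (∑ i, y i ^ 2) / s)

section GaussKernel

variable {n : ℕ} {b s τ : ℝ}

lemma gaussKernel_pos (hb : 0 < b) (hs : 0 < s) (y : Fin n → ℝ) : 0 < gaussKernel b y s := by
  unfold gaussKernel; positivity

lemma integrable_exp_neg_mul_sum_sq (hb : 0 < b) :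
    Integrable (fun y : Fin n → ℝ => Real.exp (-b * ∑ i, y i ^ 2)) := by
  simp_rw [Finset.mul_sum, Real.exp_sum]
  exact Integrable.fintype_prod (f := fun _ (x : ℝ) => Real.exp (-b * x ^ 2))
    fun _ => integrable_exp_neg_mul_sq hb

lemma integral_exp_neg_mul_sum_sq (hb : 0 < b) :
    ∫ y : Fin n → ℝ, Real.exp (-b * ∑ i, y i ^ 2) = (π / b) ^ ((n : ℝ) / 2) := by
  simp_rw [Finset.mul_sum, Real.exp_sum]
  rw [integral_fintype_prod_volume_eq_prod (fun _ (x : ℝ) => Real.exp (-b * x ^ 2))]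
  simp only [integral_gaussian, Finset.prod_const, Finset.card_univ, Fintype.card_fin]
  rw [Real.sqrt_eq_rpow, ← Real.rpow_natCast, ← Real.rpow_mul (by positivity)]
  congr 1; ring

lemma gaussKernel_eq_const_mul_exp (y : Fin n → ℝ) :
    gaussKernel b y s = (b / (π * s)) ^ ((n : ℝ) / 2) * Real.exp (-(b / s) * ∑ i, y i ^ 2) := by
  unfold gaussKernel; congr 2; ring

lemma integrable_gaussKernel (hb : 0 < b) (hs : 0 < s) :
    Integrable (fun y : Fin n → ℝ => gaussKernel b y s) := by
  simp_rw [gaussKernel_eq_const_mul_exp]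
  exact (integrable_exp_neg_mul_sum_sq (by positivity)).const_mul _

lemma integral_gaussKernel (hb : 0 < b) (hs : 0 < s) :
    ∫ y : Fin n → ℝ, gaussKernel b y s = 1 := by
  simp_rw [gaussKernel_eq_const_mul_exp]
  rw [integral_const_mul, integral_exp_neg_mul_sum_sq (by positivity),
    ← Real.mul_rpow (by positivity) (by positivity)]
  have : b / (π * s) * (π / (b / s)) = 1 := by field_simp
  rw [this, Real.one_rpow]

lemma gaussKernel_mul_gaussKernel (hb : 0 < b) (hs : 0 < s) (hsτ : s < τ) (a y : Fin n → ℝ) :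
    gaussKernel b (a - y) (τ - s) * gaussKernel b y s =
      gaussKernel b a τ * gaussKernel b (y - (s / τ) • a) (s * (τ - s) / τ) := by
  have h1 : 0 < τ - s := by linarith
  have h2 : 0 < τ := by linarith
  unfold gaussKernel
  rw [mul_mul_mul_comm, ← Real.mul_rpow (by positivity) (by positivity), ← Real.exp_add,
    mul_mul_mul_comm, ← Real.mul_rpow (by positivity) (by positivity), ← Real.exp_add]
  congr 2
  · field_simp
  · simp only [Finset.mul_sum, Finset.sum_div]
    rw [← Finset.sum_add_distrib, ← Finset.sum_add_distrib]
    refine Finset.sum_congr rfl fun i _ => ?_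
    simp only [Pi.sub_apply, Pi.smul_apply, smul_eq_mul]
    field_simp
    ring

lemma integrable_gaussKernel_mul (hb : 0 < b) (hs : 0 < s) (hsτ : s < τ) (a : Fin n → ℝ) :
    Integrable (fun y => gaussKernel b (a - y) (τ - s) * gaussKernel b y s) := by
  have h1 : 0 < τ - s := by linarith
  have h2 : 0 < τ := by linarith
  simp_rw [gaussKernel_mul_gaussKernel hb hs hsτ]
  exact ((integrable_gaussKernel hb (by positivity)).comp_sub_right _).const_mul _

lemma integral_gaussKernel_mul (hb : 0 < b) (hs : 0 < s) (hsτ : s < τ) (a : Fin n → ℝ) :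
    ∫ y, gaussKernel b (a - y) (τ - s) * gaussKernel b y s = gaussKernel b a τ := by
  have h1 : 0 < τ - s := by linarith
  have h2 : 0 < τ := by linarith
  simp_rw [gaussKernel_mul_gaussKernel hb hs hsτ]
  rw [integral_const_mul, integral_sub_right_eq_self (fun y => gaussKernel b y _),
    integral_gaussKernel hb (by positivity), mul_one]

lemma continuous_gaussKernel : Continuous (fun y : Fin n → ℝ => gaussKernel b y s) := by
  unfold gaussKernel; fun_prop

lemma hasDerivAt_gaussKernel_time (hb : 0 < b) (hs : 0 < s) (y : Fin n → ℝ) :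
    HasDerivAt (fun s => gaussKernel b y s)
      (gaussKernel b y s * (-(n / (2 * s)) + b * (∑ i, y i ^ 2) / s ^ 2)) s := by
  unfold gaussKernel
  have hπ := Real.pi_pos
  have h1 : HasDerivAt (fun s : ℝ => b / (π * s)) (-(b / π) / s ^ 2) s := by
    have e : (fun s : ℝ => b / (π * s)) = fun s => b / π * s⁻¹ := by ext x; field_simp
    rw [e]
    exact ((hasDerivAt_inv hs.ne').const_mul (b / π)).congr_deriv (by ring)
  have h2 := h1.rpow_const (p := (n : ℝ) / 2) (Or.inl (by positivity))
  have h3 : HasDerivAt (fun s : ℝ => -b * (∑ i, y i ^ 2) / s) (b * (∑ i, y i ^ 2) / s ^ 2) s := by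
    exact ((hasDerivAt_inv hs.ne').const_mul (-b * (∑ i, y i ^ 2))).congr_deriv (by ring)
  refine (h2.mul h3.exp).congr_deriv ?_
  rw [Real.rpow_sub_one (by positivity)]
  field_simp

lemma sum_sq_add_smul_single (y : Fin n → ℝ) (i : Fin n) (t : ℝ) :
    ∑ j, (y + t • (Pi.single i 1 : Fin n → ℝ)) j ^ 2 = ∑ j, y j ^ 2 + 2 * t * y i + t ^ 2 := by
  simp only [Pi.add_apply, Pi.smul_apply, smul_eq_mul, add_sq, Finset.sum_add_distrib, mul_pow]
  simp [Pi.single_apply]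
  ring

lemma hasLineDerivAt_gaussKernel (y : Fin n → ℝ) (i : Fin n) :
    HasLineDerivAt ℝ (fun y => gaussKernel b y s) (gaussKernel b y s * (-(2 * b * y i / s))) y
      (Pi.single i 1) := by
  unfold HasLineDerivAt gaussKernel
  simp_rw [sum_sq_add_smul_single]
  have h1 : HasDerivAt (fun t : ℝ => -b * (∑ j, y j ^ 2 + 2 * t * y i + t ^ 2) / s)
      (-(2 * b * y i / s)) 0 := by
    have : HasDerivAt (fun t : ℝ => ∑ j, y j ^ 2 + 2 * t * y i + t ^ 2) (2 * y i) 0 := by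
      exact (((((hasDerivAt_id (0 : ℝ)).const_mul 2).mul_const (y i)).const_add
        (∑ j, y j ^ 2)).add ((hasDerivAt_id (0 : ℝ)).pow 2)).congr_deriv (by simp)
    exact ((this.const_mul (-b)).div_const s).congr_deriv (by ring)
  refine (h1.exp.const_mul ((b / (π * s)) ^ ((n : ℝ) / 2))).congr_deriv ?_
  simp
  ring

lemma hasLineDerivAt_gaussKernel_sub (a y : Fin n → ℝ) (i : Fin n) :
    HasLineDerivAt ℝ (fun y => gaussKernel b (a - y) s)
      (gaussKernel b (a - y) s * (2 * b * (a i - y i) / s)) y (Pi.single i 1) := by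
  have h := hasLineDerivAt_gaussKernel (b := b) (s := s) (y - a) i
  have e : ∀ z : Fin n → ℝ, gaussKernel b (a - z) s = gaussKernel b (z - a) s := fun z => by
    unfold gaussKernel; congr! 5; simp only [Pi.sub_apply]; ring
  unfold HasLineDerivAt at h ⊢
  simp_rw [e]
  have e' : ∀ t : ℝ, y + t • (Pi.single i 1 : Fin n → ℝ) - a =
      y - a + t • (Pi.single i 1 : Fin n → ℝ) := fun t => by abel
  simp_rw [e']
  refine h.congr_deriv ?_
  simp only [Pi.sub_apply]; ring

end GaussKernel

section Entropy

lemma log_one_add_le_self {q : ℝ} (hq : 0 ≤ q) : Real.log (1 + q) ≤ q := by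
  have := Real.log_le_sub_one_of_pos (show 0 < 1 + q by linarith)
  linarith

lemma hasDerivAt_sub_log_one_add {q : ℝ} (hq : 0 ≤ q) :
    HasDerivAt (fun q => q - Real.log (1 + q)) (q / (1 + q)) q := by
  have h0 : 0 < 1 + q := by linarith
  refine ((hasDerivAt_id q).sub (((hasDerivAt_id q).const_add 1).log h0.ne')).congr_deriv ?_
  simp only [id]
  field_simp
  ring

lemma sq_div_one_add_le {q : ℝ} (hq : 0 ≤ q) : q ^ 2 / (1 + q) ≤ q := by
  rw [div_le_iff₀ (by positivity)]; nlinarith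

lemma sq_mul_add_two_div_le {q : ℝ} (hq : 0 ≤ q) : q ^ 2 * (q + 2) / (1 + q) ^ 2 ≤ q := by
  rw [div_le_iff₀ (by positivity)]; nlinarith

lemma abs_mul_combination_le {u q A B C D α γ g : ℝ} (hu : 0 ≤ u) (hA : 0 ≤ A) (hB : 0 ≤ B)
    (hC : 0 ≤ C) (hD : 0 ≤ D) (hα : 0 ≤ α) (hαq : α ≤ q) (hγ : 0 ≤ γ) (hγq : γ ≤ q)
    (hg : 0 ≤ g) (hgq : g ≤ q) :
    |u * (A * α - B * γ - C * g + D * g)| ≤ u * q * (A + B + C + D) := by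
  rw [abs_mul, abs_of_nonneg hu, mul_assoc]
  gcongr
  have h1 := mul_le_mul_of_nonneg_left hαq hA
  have h2 := mul_le_mul_of_nonneg_left hγq hB
  have h3 := mul_le_mul_of_nonneg_left hgq hC
  have h4 := mul_le_mul_of_nonneg_left hgq hD
  have h1' := mul_nonneg hA hα
  have h2' := mul_nonneg hB hγ
  have h3' := mul_nonneg hC hg
  have h4' := mul_nonneg hD hg
  rw [abs_le]; constructor <;> nlinarith

end Entropy

section EntropyFlow

variable {n : ℕ} {b k s τ : ℝ}

/-- The entropy density `u (q - log (1 + q))` for the backward heat kernel `u` with pole `(a, τ)`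
and `k` times the forward heat kernel `q` with pole at the origin. -/
noncomputable def entropyDensity (b k τ : ℝ) (a y : Fin n → ℝ) (s : ℝ) : ℝ :=
  gaussKernel b (a - y) (τ - s) * (k * gaussKernel b y s - Real.log (1 + k * gaussKernel b y s))

/-- The time derivative of `entropyDensity`. -/
noncomputable def entropyRate (b k τ : ℝ) (a y : Fin n → ℝ) (s : ℝ) : ℝ :=
  gaussKernel b (a - y) (τ - s) *
    (b * (∑ i, y i ^ 2) / s ^ 2 * ((k * gaussKernel b y s) ^ 2 / (1 + k * gaussKernel b y s)) -
      n / (2 * s) * ((k * gaussKernel b y s) ^ 2 / (1 + k * gaussKernel b y s)) -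
      b * (∑ i, (a i - y i) ^ 2) / (τ - s) ^ 2 *
        (k * gaussKernel b y s - Real.log (1 + k * gaussKernel b y s)) +
      n / (2 * (τ - s)) * (k * gaussKernel b y s - Real.log (1 + k * gaussKernel b y s)))

/-- The density of the rate at which the total entropy decreases. -/
noncomputable def entropyDissipation (b k τ : ℝ) (a y : Fin n → ℝ) (s : ℝ) : ℝ :=
  gaussKernel b (a - y) (τ - s) *
    (b * (∑ i, y i ^ 2) / s ^ 2 * ((k * gaussKernel b y s) ^ 2 / (1 + k * gaussKernel b y s) ^ 2))

/-- The `i`-th component of the entropy flux. -/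
noncomputable def entropyFlux (b k τ : ℝ) (a : Fin n → ℝ) (i : Fin n) (y : Fin n → ℝ) (s : ℝ) :
    ℝ :=
  -(1 / 2) * (gaussKernel b (a - y) (τ - s) *
    (y i / s * ((k * gaussKernel b y s) ^ 2 / (1 + k * gaussKernel b y s)) +
      (a i - y i) / (τ - s) * (k * gaussKernel b y s - Real.log (1 + k * gaussKernel b y s))))

/-- The `i`-th partial derivative of the `i`-th component of the entropy flux. -/
noncomputable def entropyFluxDeriv (b k τ : ℝ) (a : Fin n → ℝ) (i : Fin n) (y : Fin n → ℝ)
    (s : ℝ) : ℝ :=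
  gaussKernel b (a - y) (τ - s) *
    (b * y i ^ 2 / s ^ 2 *
        ((k * gaussKernel b y s) ^ 2 * (k * gaussKernel b y s + 2) /
          (1 + k * gaussKernel b y s) ^ 2) -
      1 / (2 * s) * ((k * gaussKernel b y s) ^ 2 / (1 + k * gaussKernel b y s)) -
      b * (a i - y i) ^ 2 / (τ - s) ^ 2 *
        (k * gaussKernel b y s - Real.log (1 + k * gaussKernel b y s)) +
      1 / (2 * (τ - s)) * (k * gaussKernel b y s - Real.log (1 + k * gaussKernel b y s)))

lemma hasDerivAt_entropyDensity (hb : 0 < b) (hk : 0 < k) (hs : 0 < s) (hsτ : s < τ)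
    (a y : Fin n → ℝ) :
    HasDerivAt (fun s => entropyDensity b k τ a y s) (entropyRate b k τ a y s) s := by
  have h1 : 0 < τ - s := by linarith
  have hq : 0 < k * gaussKernel b y s := mul_pos hk (gaussKernel_pos hb hs y)
  have hu : HasDerivAt (fun s => gaussKernel b (a - y) (τ - s)) _ s :=
    (hasDerivAt_gaussKernel_time hb h1 (a - y)).comp s ((hasDerivAt_id s).const_sub τ)
  have hg : HasDerivAt (fun s => k * gaussKernel b y s - Real.log (1 + k * gaussKernel b y s)) _ s :=
    (hasDerivAt_sub_log_one_add hq.le).comp (h := fun s => k * gaussKernel b y s) s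
      ((hasDerivAt_gaussKernel_time hb hs y).const_mul k)
  refine (hu.mul hg).congr_deriv ?_
  unfold entropyRate
  simp only [Pi.sub_apply]
  generalize k * gaussKernel b y s - Real.log (1 + k * gaussKernel b y s) = g
  generalize gaussKernel b (a - y) (τ - s) = u
  simp only [← mul_assoc k]
  generalize k * gaussKernel b y s = q at hq
  have : 1 + q ≠ 0 := by positivity
  ring

lemma hasLineDerivAt_entropyFlux (hb : 0 < b) (hk : 0 < k) (hs : 0 < s) (hsτ : s < τ)
    (a y : Fin n → ℝ) (i : Fin n) :
    HasLineDerivAt ℝ (fun y => entropyFlux b k τ a i y s) (entropyFluxDeriv b k τ a i y s) y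
      (Pi.single i 1) := by
  have h1 : 0 < τ - s := by linarith
  have hqk := gaussKernel_pos hb hs y
  have hu := hasLineDerivAt_gaussKernel_sub (b := b) (s := τ - s) a y i
  have hv := hasLineDerivAt_gaussKernel (b := b) (s := s) y i
  unfold HasLineDerivAt at hu hv ⊢
  set e : Fin n → ℝ := Pi.single i 1 with he
  have hy : HasDerivAt (fun t : ℝ => (y + t • e) i) 1 0 := by
    have : ∀ t : ℝ, (y + t • e) i = y i + t := fun t => by simp [he]
    simp_rw [this]
    exact (hasDerivAt_id _).const_add _
  have e0 : y + (0 : ℝ) • e = y := by simp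
  have hq := hv.const_mul k
  have hq0 : 0 < k * gaussKernel b (y + (0 : ℝ) • e) s := by rw [e0]; positivity
  have hg : HasDerivAt (fun t : ℝ => k * gaussKernel b (y + t • e) s -
      Real.log (1 + k * gaussKernel b (y + t • e) s)) _ 0 :=
    (hasDerivAt_sub_log_one_add hq0.le).comp (h := fun t : ℝ => k * gaussKernel b (y + t • e) s) 0 hq
  have hr := (hq.pow 2).div (hq.const_add 1) (by positivity)
  refine ((hu.mul (((hy.div_const s).mul hr).add (((hy.const_sub (a i)).div_const (τ - s)).mul
    hg))).const_mul (-(1 / 2))).congr_deriv ?_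
  unfold entropyFluxDeriv
  rw [e0] at hq0 ⊢
  simp only [Pi.add_apply, Pi.mul_apply, Pi.div_apply, Pi.pow_apply, zero_smul, add_zero, Pi.zero_apply]
  generalize k * gaussKernel b y s - Real.log (1 + k * gaussKernel b y s) = g
  generalize gaussKernel b (a - y) (τ - s) = u
  simp only [← mul_assoc k]
  generalize k * gaussKernel b y s = q at hq0
  have : 1 + q ≠ 0 := by positivity
  generalize τ - s = σ at h1
  field_simp
  ring

lemma sum_entropyFluxDeriv (hb : 0 < b) (hk : 0 < k) (hs : 0 < s) (a y : Fin n → ℝ) :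
    ∑ i, entropyFluxDeriv b k τ a i y s =
      entropyRate b k τ a y s + entropyDissipation b k τ a y s := by
  have hq : 0 < k * gaussKernel b y s := mul_pos hk (gaussKernel_pos hb hs y)
  unfold entropyFluxDeriv entropyRate entropyDissipation
  rw [← Finset.mul_sum, ← mul_add]
  congr 1
  simp only [Finset.sum_add_distrib, Finset.sum_sub_distrib, ← Finset.sum_mul, ← Finset.sum_div,
    ← Finset.mul_sum, Finset.sum_const, Finset.card_univ, Fintype.card_fin, nsmul_eq_mul]
  generalize k * gaussKernel b y s - Real.log (1 + k * gaussKernel b y s) = g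
  generalize k * gaussKernel b y s = q at hq
  have : 1 + q ≠ 0 := by positivity
  have e : q ^ 2 * (q + 2) / (1 + q) ^ 2 = q ^ 2 / (1 + q) + q ^ 2 / (1 + q) ^ 2 := by
    field_simp; ring
  rw [e]
  ring

end EntropyFlow

section EntropyIntegral

variable {n : ℕ} {b k s s₁ s₂ τ : ℝ}

lemma one_add_mul_exp_neg_le {c x : ℝ} (hc : 0 < c) (hx : 0 ≤ x) :
    (1 + x) * Real.exp (-c * x) ≤ (1 + 2 / c) * Real.exp (-(c / 2) * x) := by
  have h1 : 1 + x ≤ (1 + 2 / c) * Real.exp (c / 2 * x) := by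
    have h := Real.add_one_le_exp (c / 2 * x)
    have h2 : 0 ≤ c / 2 * x := by positivity
    calc 1 + x ≤ (1 + 2 / c) * (c / 2 * x + 1) := by
          have : 2 / c * (c / 2 * x) = x := by field_simp
          have : 0 < 2 / c := by positivity
          nlinarith
      _ ≤ _ := by gcongr
  calc (1 + x) * Real.exp (-c * x) ≤ (1 + 2 / c) * Real.exp (c / 2 * x) * Real.exp (-c * x) := by
        gcongr
    _ = _ := by rw [mul_assoc, ← Real.exp_add]; congr 2; ring

lemma exists_integrable_dominating (hb : 0 < b) (h₁ : 0 < s₁) (h₁₂ : s₁ ≤ s₂) (h₂ : s₂ < τ)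
    (a : Fin n → ℝ) :
    ∃ D : (Fin n → ℝ) → ℝ, Integrable D ∧ ∀ s ∈ Set.Icc s₁ s₂, ∀ y,
      gaussKernel b (a - y) (τ - s) * gaussKernel b y s * (1 + ∑ i, y i ^ 2) ≤ D y := by
  have h₂' : 0 < s₂ := by linarith
  have h₃ : 0 < τ - s₂ := by linarith
  refine ⟨fun y => (b / (π * (τ - s₂))) ^ ((n : ℝ) / 2) * (b / (π * s₁)) ^ ((n : ℝ) / 2) *
    ((1 + 2 / (b / s₂)) * Real.exp (-(b / s₂ / 2) * ∑ i, y i ^ 2)), ?_, ?_⟩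
  · exact ((integrable_exp_neg_mul_sum_sq (by positivity)).const_mul _).const_mul _
  · rintro s ⟨hs1, hs2⟩ y
    have hs : 0 < s := by linarith
    have hS : 0 ≤ ∑ i, y i ^ 2 := by positivity
    have hS' : 0 ≤ ∑ i, (a - y) i ^ 2 := by positivity
    have hτs : 0 < τ - s := by linarith
    have e1 : gaussKernel b (a - y) (τ - s) ≤ (b / (π * (τ - s₂))) ^ ((n : ℝ) / 2) := by
      unfold gaussKernel
      calc _ ≤ (b / (π * (τ - s₂))) ^ ((n : ℝ) / 2) * 1 := by
            gcongr
            rw [Real.exp_le_one_iff, neg_mul, neg_div]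
            exact neg_nonpos.2 (by positivity)
        _ = _ := mul_one _
    have e2 : gaussKernel b y s ≤
        (b / (π * s₁)) ^ ((n : ℝ) / 2) * Real.exp (-(b / s₂) * ∑ i, y i ^ 2) := by
      rw [gaussKernel_eq_const_mul_exp]
      gcongr
    have p1 := (gaussKernel_pos hb hτs (a - y)).le
    have p2 := (gaussKernel_pos hb hs y).le
    calc _ ≤ (b / (π * (τ - s₂))) ^ ((n : ℝ) / 2) * ((b / (π * s₁)) ^ ((n : ℝ) / 2) *
          Real.exp (-(b / s₂) * ∑ i, y i ^ 2)) * (1 + ∑ i, y i ^ 2) := by gcongr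
      _ = (b / (π * (τ - s₂))) ^ ((n : ℝ) / 2) * (b / (π * s₁)) ^ ((n : ℝ) / 2) *
          ((1 + ∑ i, y i ^ 2) * Real.exp (-(b / s₂) * ∑ i, y i ^ 2)) := by ring
      _ ≤ _ := mul_le_mul_of_nonneg_left (one_add_mul_exp_neg_le (by positivity) hS)
        (by positivity)

lemma integrable_of_abs_le_gaussKernel (hb : 0 < b) (hs : 0 < s) (hsτ : s < τ) (a : Fin n → ℝ)
    {F : (Fin n → ℝ) → ℝ} (hF : Continuous F) (C : ℝ)
    (h : ∀ y, |F y| ≤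
      C * (gaussKernel b (a - y) (τ - s) * gaussKernel b y s * (1 + ∑ i, y i ^ 2))) :
    Integrable F := by
  obtain ⟨D, hD, hle⟩ := exists_integrable_dominating hb hs le_rfl hsτ a
  refine (hD.const_mul |C|).mono' hF.aestronglyMeasurable (ae_of_all _ fun y => ?_)
  have p1 := (gaussKernel_pos hb (sub_pos.2 hsτ) (a - y)).le
  have p2 := (gaussKernel_pos hb hs y).le
  refine (h y).trans ?_
  calc _ ≤ |C| * (gaussKernel b (a - y) (τ - s) * gaussKernel b y s * (1 + ∑ i, y i ^ 2)) := by
        gcongr; exact le_abs_self C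
    _ ≤ _ := by gcongr; exact hle s ⟨le_rfl, le_rfl⟩ y

lemma sum_sub_sq_le (a y : Fin n → ℝ) :
    ∑ i, (a i - y i) ^ 2 ≤ 2 * ∑ i, a i ^ 2 + 2 * ∑ i, y i ^ 2 := by
  rw [Finset.mul_sum, Finset.mul_sum, ← Finset.sum_add_distrib]
  exact Finset.sum_le_sum fun i _ => by nlinarith [sq_nonneg (a i + y i)]

lemma sq_le_sum_sq (y : Fin n → ℝ) (i : Fin n) : y i ^ 2 ≤ ∑ j, y j ^ 2 :=
  Finset.single_le_sum (f := fun j => y j ^ 2) (fun _ _ => sq_nonneg _) (Finset.mem_univ i)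

lemma abs_entropyRate_le (hb : 0 < b) (hk : 0 < k) (h₁ : 0 < s₁) (h₂ : s₂ < τ) (a : Fin n → ℝ)
    (hs : s ∈ Set.Icc s₁ s₂) (y : Fin n → ℝ) :
    |entropyRate b k τ a y s| ≤
      k * (b / s₁ ^ 2 + n / (2 * s₁) + b * (2 * ∑ i, a i ^ 2 + 2) / (τ - s₂) ^ 2 +
        n / (2 * (τ - s₂))) *
      (gaussKernel b (a - y) (τ - s) * gaussKernel b y s * (1 + ∑ i, y i ^ 2)) := by
  obtain ⟨hs1, hs2⟩ := hs
  have hs0 : 0 < s := by linarith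
  have h₃ : 0 < τ - s₂ := by linarith
  have hτs : 0 < τ - s := by linarith
  have p1 := gaussKernel_pos hb hτs (a - y)
  have p2 := gaussKernel_pos hb hs0 y
  have hq : 0 < k * gaussKernel b y s := by positivity
  have hS : 0 ≤ ∑ i, y i ^ 2 := by positivity
  have hA : 0 ≤ ∑ i, a i ^ 2 := by positivity
  have hS' : 0 ≤ ∑ i, (a i - y i) ^ 2 := by positivity
  refine (abs_mul_combination_le p1.le (by positivity) (by positivity) (by positivity)
    (by positivity) (by positivity) (sq_div_one_add_le hq.le) (by positivity)
    (sq_div_one_add_le hq.le) (sub_nonneg.2 (log_one_add_le_self hq.le))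
    (sub_le_self _ (Real.log_nonneg (by linarith)))).trans ?_
  have hs2τ : τ - s₂ ≤ τ - s := by linarith
  have e1 : b * (∑ i, y i ^ 2) / s ^ 2 ≤ b / s₁ ^ 2 * (1 + ∑ i, y i ^ 2) := by
    rw [mul_div_right_comm]; gcongr; linarith
  have e2 : n / (2 * s) ≤ n / (2 * s₁) * (1 + ∑ i, y i ^ 2) :=
    calc n / (2 * s) ≤ n / (2 * s₁) * 1 := by rw [mul_one]; gcongr
      _ ≤ _ := by gcongr; linarith
  have e3 : b * (∑ i, (a i - y i) ^ 2) / (τ - s) ^ 2 ≤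
      b * (2 * ∑ i, a i ^ 2 + 2) / (τ - s₂) ^ 2 * (1 + ∑ i, y i ^ 2) := by
    rw [← mul_div_right_comm, mul_assoc]
    gcongr
    nlinarith [sum_sub_sq_le a y]
  have e4 : n / (2 * (τ - s)) ≤ n / (2 * (τ - s₂)) * (1 + ∑ i, y i ^ 2) :=
    calc n / (2 * (τ - s)) ≤ n / (2 * (τ - s₂)) * 1 := by rw [mul_one]; gcongr
      _ ≤ _ := by gcongr; linarith
  calc _ ≤ gaussKernel b (a - y) (τ - s) * (k * gaussKernel b y s) *
        (b / s₁ ^ 2 * (1 + ∑ i, y i ^ 2) + n / (2 * s₁) * (1 + ∑ i, y i ^ 2) +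
          b * (2 * ∑ i, a i ^ 2 + 2) / (τ - s₂) ^ 2 * (1 + ∑ i, y i ^ 2) +
          n / (2 * (τ - s₂)) * (1 + ∑ i, y i ^ 2)) := by gcongr
    _ = _ := by ring

lemma abs_entropyFluxDeriv_le (hb : 0 < b) (hk : 0 < k) (hs : 0 < s) (hsτ : s < τ)
    (a y : Fin n → ℝ) (i : Fin n) :
    |entropyFluxDeriv b k τ a i y s| ≤
      k * (b / s ^ 2 + 1 / (2 * s) + b * (2 * ∑ i, a i ^ 2 + 2) / (τ - s) ^ 2 +
        1 / (2 * (τ - s))) *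
      (gaussKernel b (a - y) (τ - s) * gaussKernel b y s * (1 + ∑ i, y i ^ 2)) := by
  have hτs : 0 < τ - s := by linarith
  have p1 := gaussKernel_pos hb hτs (a - y)
  have p2 := gaussKernel_pos hb hs y
  have hq : 0 < k * gaussKernel b y s := by positivity
  have hS : 0 ≤ ∑ i, y i ^ 2 := by positivity
  have hA : 0 ≤ ∑ i, a i ^ 2 := by positivity
  refine (abs_mul_combination_le p1.le (by positivity) (by positivity) (by positivity)
    (by positivity) (by positivity) (sq_mul_add_two_div_le hq.le) (by positivity)
    (sq_div_one_add_le hq.le) (sub_nonneg.2 (log_one_add_le_self hq.le))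
    (sub_le_self _ (Real.log_nonneg (by linarith)))).trans ?_
  have e1 : b * y i ^ 2 / s ^ 2 ≤ b / s ^ 2 * (1 + ∑ i, y i ^ 2) := by
    rw [mul_div_right_comm]; gcongr; linarith [sq_le_sum_sq y i]
  have e2 : 1 / (2 * s) ≤ 1 / (2 * s) * (1 + ∑ i, y i ^ 2) :=
    le_mul_of_one_le_right (by positivity) (by linarith)
  have e3 : b * (a i - y i) ^ 2 / (τ - s) ^ 2 ≤
      b * (2 * ∑ i, a i ^ 2 + 2) / (τ - s) ^ 2 * (1 + ∑ i, y i ^ 2) := by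
    rw [← mul_div_right_comm, mul_assoc]
    gcongr
    nlinarith [sum_sub_sq_le a y, sq_le_sum_sq (a - y) i, Pi.sub_apply a y i,
      show ∑ j, (a - y) j ^ 2 = ∑ j, (a j - y j) ^ 2 from rfl,
      show (a - y) i ^ 2 = (a i - y i) ^ 2 from rfl]
  have e4 : 1 / (2 * (τ - s)) ≤ 1 / (2 * (τ - s)) * (1 + ∑ i, y i ^ 2) :=
    le_mul_of_one_le_right (by positivity) (by linarith)
  calc _ ≤ gaussKernel b (a - y) (τ - s) * (k * gaussKernel b y s) *
        (b / s ^ 2 * (1 + ∑ i, y i ^ 2) + 1 / (2 * s) * (1 + ∑ i, y i ^ 2) +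
          b * (2 * ∑ i, a i ^ 2 + 2) / (τ - s) ^ 2 * (1 + ∑ i, y i ^ 2) +
          1 / (2 * (τ - s)) * (1 + ∑ i, y i ^ 2)) := by gcongr
    _ = _ := by ring

lemma abs_entropyFlux_le (hb : 0 < b) (hk : 0 < k) (hs : 0 < s) (hsτ : s < τ)
    (a y : Fin n → ℝ) (i : Fin n) :
    |entropyFlux b k τ a i y s| ≤
      k * (1 / s + (2 * ∑ i, a i ^ 2 + 2) / (τ - s)) *
      (gaussKernel b (a - y) (τ - s) * gaussKernel b y s * (1 + ∑ i, y i ^ 2)) := by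
  have hτs : 0 < τ - s := by linarith
  have p1 := gaussKernel_pos hb hτs (a - y)
  have p2 := gaussKernel_pos hb hs y
  have hq : 0 < k * gaussKernel b y s := by positivity
  have hS : 0 ≤ ∑ i, y i ^ 2 := by positivity
  have hA : 0 ≤ ∑ i, a i ^ 2 := by positivity
  have e1 : |y i| ≤ 1 + ∑ i, y i ^ 2 := by
    nlinarith [sq_le_sum_sq y i, sq_abs (y i), sq_nonneg (|y i| - 1), abs_nonneg (y i)]
  have e2 : |a i - y i| ≤ (2 * ∑ i, a i ^ 2 + 2) * (1 + ∑ i, y i ^ 2) := by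
    have h := sq_le_sum_sq (a - y) i
    have h' := sum_sub_sq_le a y
    simp only [Pi.sub_apply] at h
    nlinarith [sq_abs (a i - y i), sq_nonneg (|a i - y i| - 1), mul_nonneg hA hS]
  have hg0 := sub_nonneg.2 (log_one_add_le_self hq.le)
  have hg1 : k * gaussKernel b y s - Real.log (1 + k * gaussKernel b y s) ≤ k * gaussKernel b y s :=
    sub_le_self _ (Real.log_nonneg (by linarith))
  have hr1 := sq_div_one_add_le hq.le
  have hr0 : 0 ≤ (k * gaussKernel b y s) ^ 2 / (1 + k * gaussKernel b y s) := by positivity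
  unfold entropyFlux
  rw [abs_mul, abs_mul, abs_of_pos p1]
  have e3 : |y i / s * ((k * gaussKernel b y s) ^ 2 / (1 + k * gaussKernel b y s)) +
      (a i - y i) / (τ - s) * (k * gaussKernel b y s - Real.log (1 + k * gaussKernel b y s))| ≤
      (1 + ∑ i, y i ^ 2) / s * (k * gaussKernel b y s) +
      (2 * ∑ i, a i ^ 2 + 2) * (1 + ∑ i, y i ^ 2) / (τ - s) * (k * gaussKernel b y s) := by
    refine (abs_add_le _ _).trans ?_
    rw [abs_mul, abs_mul, abs_of_nonneg hr0, abs_of_nonneg hg0, abs_div, abs_div, abs_of_pos hs,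
      abs_of_pos hτs]
    gcongr
  have e4 : |(-(1 / 2) : ℝ)| ≤ 1 := by rw [abs_neg, abs_of_pos] <;> norm_num
  refine (mul_le_mul e4 (mul_le_mul_of_nonneg_left e3 p1.le) (by positivity) zero_le_one).trans_eq ?_
  ring

lemma entropyDensity_nonneg (hb : 0 < b) (hk : 0 < k) (hs : 0 < s) (hsτ : s < τ)
    (a y : Fin n → ℝ) : 0 ≤ entropyDensity b k τ a y s := by
  have p1 := gaussKernel_pos hb (sub_pos.2 hsτ) (a - y)
  have p2 := gaussKernel_pos hb hs y
  exact mul_nonneg p1.le (sub_nonneg.2 (log_one_add_le_self (by positivity)))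

lemma entropyDensity_le (hb : 0 < b) (hk : 0 < k) (hs : 0 < s) (hsτ : s < τ)
    (a y : Fin n → ℝ) : entropyDensity b k τ a y s ≤
      k * (gaussKernel b (a - y) (τ - s) * gaussKernel b y s) := by
  have p1 := gaussKernel_pos hb (sub_pos.2 hsτ) (a - y)
  have p2 := gaussKernel_pos hb hs y
  have : 0 ≤ Real.log (1 + k * gaussKernel b y s) :=
    Real.log_nonneg (by nlinarith [mul_pos hk p2])
  unfold entropyDensity
  nlinarith [mul_nonneg p1.le this]

lemma entropyDissipation_nonneg (hb : 0 < b) (hsτ : s < τ)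
    (a y : Fin n → ℝ) : 0 ≤ entropyDissipation b k τ a y s := by
  have p1 := gaussKernel_pos hb (sub_pos.2 hsτ) (a - y)
  unfold entropyDissipation
  positivity

lemma continuous_gaussKernel_sub (a : Fin n → ℝ) :
    Continuous (fun y : Fin n → ℝ => gaussKernel b (a - y) s) :=
  continuous_gaussKernel.comp (continuous_const.sub continuous_id)

lemma one_add_mul_gaussKernel_ne_zero (hb : 0 < b) (hk : 0 < k) (hs : 0 < s) (y : Fin n → ℝ) :
    1 + k * gaussKernel b y s ≠ 0 := by
  have := gaussKernel_pos hb hs y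
  positivity

lemma continuous_log_gaussKernel (hb : 0 < b) (hk : 0 < k) (hs : 0 < s) :
    Continuous (fun y : Fin n → ℝ => Real.log (1 + k * gaussKernel b y s)) :=
  ((continuous_const.mul continuous_gaussKernel).const_add 1).log
    (one_add_mul_gaussKernel_ne_zero hb hk hs)

lemma continuous_entropyDensity (hb : 0 < b) (hk : 0 < k) (hs : 0 < s) (a : Fin n → ℝ) :
    Continuous (fun y => entropyDensity b k τ a y s) := by
  have h1 := continuous_gaussKernel_sub (b := b) (s := τ - s) a
  have h2 := continuous_gaussKernel (n := n) (b := b) (s := s)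
  have h3 := continuous_log_gaussKernel (n := n) hb hk hs
  unfold entropyDensity
  fun_prop

lemma continuous_entropyRate (hb : 0 < b) (hk : 0 < k) (hs : 0 < s) (a : Fin n → ℝ) :
    Continuous (fun y => entropyRate b k τ a y s) := by
  have h1 := continuous_gaussKernel_sub (b := b) (s := τ - s) a
  have h2 := continuous_gaussKernel (n := n) (b := b) (s := s)
  have h3 := continuous_log_gaussKernel (n := n) hb hk hs
  have h4 := one_add_mul_gaussKernel_ne_zero (n := n) hb hk hs
  unfold entropyRate
  fun_prop (disch := assumption)

lemma continuous_entropyFlux (hb : 0 < b) (hk : 0 < k) (hs : 0 < s) (a : Fin n → ℝ) (i : Fin n) :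
    Continuous (fun y => entropyFlux b k τ a i y s) := by
  have h1 := continuous_gaussKernel_sub (b := b) (s := τ - s) a
  have h2 := continuous_gaussKernel (n := n) (b := b) (s := s)
  have h3 := continuous_log_gaussKernel (n := n) hb hk hs
  have h4 := one_add_mul_gaussKernel_ne_zero (n := n) hb hk hs
  unfold entropyFlux
  fun_prop (disch := assumption)

lemma continuous_entropyFluxDeriv (hb : 0 < b) (hk : 0 < k) (hs : 0 < s) (a : Fin n → ℝ)
    (i : Fin n) : Continuous (fun y => entropyFluxDeriv b k τ a i y s) := by
  have h1 := continuous_gaussKernel_sub (b := b) (s := τ - s) a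
  have h2 := continuous_gaussKernel (n := n) (b := b) (s := s)
  have h3 := continuous_log_gaussKernel (n := n) hb hk hs
  have h4 := one_add_mul_gaussKernel_ne_zero (n := n) hb hk hs
  have h5 : ∀ y : Fin n → ℝ, (1 + k * gaussKernel b y s) ^ 2 ≠ 0 := fun y => pow_ne_zero 2 (h4 y)
  unfold entropyFluxDeriv
  fun_prop (disch := assumption)

lemma integral_eq_zero_of_hasLineDerivAt {E : Type*} [NormedAddCommGroup E] [NormedSpace ℝ E]
    [MeasurableSpace E] [BorelSpace E] [FiniteDimensional ℝ E] {μ : Measure E}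
    [μ.IsAddHaarMeasure] {g g' : E → ℝ} {v : E} (hg : Integrable g μ) (hg' : Integrable g' μ)
    (h : ∀ x, HasLineDerivAt ℝ g (g' x) x v) : ∫ x, g' x ∂μ = 0 := by
  have key := integral_bilinear_hasLineDerivAt_right_eq_neg_left_of_integrable (μ := μ)
    (f := fun _ : E => (1 : ℝ)) (f' := fun _ => 0) (g := g) (g' := g') (v := v)
    (B := ContinuousLinearMap.mul ℝ ℝ) (by simp) (by simpa using hg')
    (by simpa using hg) (fun x _ => by
      unfold HasLineDerivAt
      exact hasDerivAt_const _ _) (fun x _ => h x)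
  simpa using key

lemma integrable_entropyDensity (hb : 0 < b) (hk : 0 < k) (hs : 0 < s) (hsτ : s < τ)
    (a : Fin n → ℝ) : Integrable (fun y => entropyDensity b k τ a y s) := by
  refine ((integrable_gaussKernel_mul hb hs hsτ a).const_mul k).mono'
    (continuous_entropyDensity hb hk hs a).aestronglyMeasurable (ae_of_all _ fun y => ?_)
  rw [Real.norm_of_nonneg (entropyDensity_nonneg hb hk hs hsτ a y)]
  exact entropyDensity_le hb hk hs hsτ a y

lemma integrable_entropyRate (hb : 0 < b) (hk : 0 < k) (hs : 0 < s) (hsτ : s < τ)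
    (a : Fin n → ℝ) : Integrable (fun y => entropyRate b k τ a y s) :=
  integrable_of_abs_le_gaussKernel hb hs hsτ a (continuous_entropyRate hb hk hs a) _
    fun y => abs_entropyRate_le hb hk hs hsτ a ⟨le_rfl, le_rfl⟩ y

lemma integrable_entropyFluxDeriv (hb : 0 < b) (hk : 0 < k) (hs : 0 < s) (hsτ : s < τ)
    (a : Fin n → ℝ) (i : Fin n) : Integrable (fun y => entropyFluxDeriv b k τ a i y s) :=
  integrable_of_abs_le_gaussKernel hb hs hsτ a (continuous_entropyFluxDeriv hb hk hs a i) _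
    fun y => abs_entropyFluxDeriv_le hb hk hs hsτ a y i

lemma integral_entropyFluxDeriv (hb : 0 < b) (hk : 0 < k) (hs : 0 < s) (hsτ : s < τ)
    (a : Fin n → ℝ) (i : Fin n) : ∫ y, entropyFluxDeriv b k τ a i y s = 0 :=
  integral_eq_zero_of_hasLineDerivAt
    (integrable_of_abs_le_gaussKernel hb hs hsτ a (continuous_entropyFlux hb hk hs a i) _
      fun y => abs_entropyFlux_le hb hk hs hsτ a y i)
    (integrable_entropyFluxDeriv hb hk hs hsτ a i)
    fun y => hasLineDerivAt_entropyFlux hb hk hs hsτ a y i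

lemma integrable_entropyDissipation (hb : 0 < b) (hk : 0 < k) (hs : 0 < s) (hsτ : s < τ)
    (a : Fin n → ℝ) : Integrable (fun y => entropyDissipation b k τ a y s) := by
  have h : (fun y => entropyDissipation b k τ a y s) =
      fun y => ∑ i, entropyFluxDeriv b k τ a i y s - entropyRate b k τ a y s := by
    ext y; rw [sum_entropyFluxDeriv hb hk hs a y]; ring
  rw [h]
  exact (integrable_finsetSum _ fun i _ => integrable_entropyFluxDeriv hb hk hs hsτ a i).sub
    (integrable_entropyRate hb hk hs hsτ a)

lemma integral_entropyRate (hb : 0 < b) (hk : 0 < k) (hs : 0 < s) (hsτ : s < τ)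
    (a : Fin n → ℝ) :
    ∫ y, entropyRate b k τ a y s = -∫ y, entropyDissipation b k τ a y s := by
  rw [← add_eq_zero_iff_eq_neg, ← integral_add (integrable_entropyRate hb hk hs hsτ a)
    (integrable_entropyDissipation hb hk hs hsτ a)]
  simp_rw [← sum_entropyFluxDeriv hb hk hs a]
  rw [integral_finsetSum _ fun i _ => integrable_entropyFluxDeriv hb hk hs hsτ a i]
  exact Finset.sum_eq_zero fun i _ => integral_entropyFluxDeriv hb hk hs hsτ a i

lemma hasDerivAt_integral_entropyDensity (hb : 0 < b) (hk : 0 < k) (hs : 0 < s) (hsτ : s < τ)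
    (a : Fin n → ℝ) :
    HasDerivAt (fun s => ∫ y, entropyDensity b k τ a y s)
      (-∫ y, entropyDissipation b k τ a y s) s := by
  obtain ⟨s₁, h₁, h₁s⟩ := exists_between hs
  obtain ⟨s₂, h₂s, h₂⟩ := exists_between hsτ
  obtain ⟨D, hD, hle⟩ := exists_integrable_dominating hb h₁ (h₁s.trans h₂s).le h₂ a
  rw [← integral_entropyRate hb hk hs hsτ a]
  have hA : 0 ≤ ∑ i, a i ^ 2 := by positivity
  have h₂' : 0 < τ - s₂ := by linarith
  refine (hasDerivAt_integral_of_dominated_loc_of_deriv_le (𝕜 := ℝ) (s := Set.Ioo s₁ s₂)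
    (bound := fun y => k * (b / s₁ ^ 2 + n / (2 * s₁) +
      b * (2 * ∑ i, a i ^ 2 + 2) / (τ - s₂) ^ 2 + n / (2 * (τ - s₂))) * D y)
    (F := fun s y => entropyDensity b k τ a y s)
    (F' := fun s y => entropyRate b k τ a y s) (Ioo_mem_nhds h₁s h₂s) ?_
    (integrable_entropyDensity hb hk hs hsτ a)
    (continuous_entropyRate hb hk hs a).aestronglyMeasurable
    (ae_of_all _ fun y σ hσ => ?_) (hD.const_mul _) (ae_of_all _ fun y σ hσ => ?_)).2
  · filter_upwards [Ioo_mem_nhds h₁s h₂s] with σ hσ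
    exact (continuous_entropyDensity hb hk (h₁.trans hσ.1) a).aestronglyMeasurable
  · have hσ' : σ ∈ Set.Icc s₁ s₂ := Set.Ioo_subset_Icc_self hσ
    refine (abs_entropyRate_le hb hk h₁ h₂ a hσ' y).trans ?_
    gcongr
    exact hle σ hσ' y
  · exact hasDerivAt_entropyDensity hb hk (h₁.trans hσ.1) (hσ.2.trans h₂) a y

lemma integral_entropyDensity_le (hb : 0 < b) (hk : 0 < k) (hs : 0 < s) (hsτ : s < τ)
    (a : Fin n → ℝ) : ∫ y, entropyDensity b k τ a y s ≤ k * gaussKernel b a τ := by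
  rw [← integral_gaussKernel_mul hb hs hsτ a, ← integral_const_mul]
  exact integral_mono (integrable_entropyDensity hb hk hs hsτ a)
    ((integrable_gaussKernel_mul hb hs hsτ a).const_mul k)
    fun y => entropyDensity_le hb hk hs hsτ a y

lemma lintegral_Ioc_entropyDissipation_le (hb : 0 < b) (hk : 0 < k) (h₁ : 0 < s₁) (h₁₂ : s₁ ≤ s₂)
    (h₂ : s₂ < τ) (a : Fin n → ℝ) :
    ∫⁻ s in Set.Ioc s₁ s₂, ∫⁻ y, ENNReal.ofReal (entropyDissipation b k τ a y s) ≤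
      ENNReal.ofReal (k * gaussKernel b a τ) := by
  have hder : ∀ s ∈ Set.Icc s₁ s₂, HasDerivAt (fun s => -∫ y, entropyDensity b k τ a y s)
      (∫ y, entropyDissipation b k τ a y s) s := fun s hs =>
    (hasDerivAt_integral_entropyDensity hb hk (h₁.trans_le hs.1)
      (hs.2.trans_lt h₂) a).neg.congr_deriv (neg_neg _)
  have hnn : ∀ s ∈ Set.Icc s₁ s₂, 0 ≤ ∫ y, entropyDissipation b k τ a y s := fun s hs =>
    integral_nonneg fun y => entropyDissipation_nonneg hb (hs.2.trans_lt h₂) a y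
  have hint : IntegrableOn (fun s => ∫ y, entropyDissipation b k τ a y s) (Set.Ioc s₁ s₂) :=
    intervalIntegral.integrableOn_deriv_of_nonneg
      (fun s hs => (hder s hs).continuousAt.continuousWithinAt)
      (fun s hs => hder s (Set.Ioo_subset_Icc_self hs))
      fun s hs => hnn s (Set.Ioo_subset_Icc_self hs)
  have hftc := intervalIntegral.integral_eq_sub_of_hasDerivAt
    (fun s hs => hder s (by rwa [Set.uIcc_of_le h₁₂] at hs))
    ((intervalIntegrable_iff_integrableOn_Ioc_of_le h₁₂).2 hint)
  rw [intervalIntegral.integral_of_le h₁₂] at hftc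
  calc _ = ∫⁻ s in Set.Ioc s₁ s₂, ENNReal.ofReal (∫ y, entropyDissipation b k τ a y s) := by
        refine setLIntegral_congr_fun measurableSet_Ioc fun s hs => ?_
        have hs1 := h₁.trans hs.1
        have hs2 := hs.2.trans_lt h₂
        exact (ofReal_integral_eq_lintegral_ofReal
          (integrable_entropyDissipation hb hk hs1 hs2 a)
          (ae_of_all _ fun y => entropyDissipation_nonneg hb hs2 a y)).symm
    _ = ENNReal.ofReal (∫ s in Set.Ioc s₁ s₂, ∫ y, entropyDissipation b k τ a y s) :=
        (ofReal_integral_eq_lintegral_ofReal hint ((ae_restrict_iff' measurableSet_Ioc).2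
          (ae_of_all _ fun s hs => hnn s (Set.Ioc_subset_Icc_self hs)))).symm
    _ ≤ _ := by
        refine ENNReal.ofReal_le_ofReal ?_
        rw [hftc]
        have e1 := integral_entropyDensity_le hb hk h₁ (h₁₂.trans_lt h₂) a
        have e2 : 0 ≤ ∫ y, entropyDensity b k τ a y s₂ := integral_nonneg fun y =>
          entropyDensity_nonneg hb hk (h₁.trans_le h₁₂) h₂ a y
        linarith

/-- The total dissipation over the life time `(0, τ)` is at most the initial entropy. -/
lemma lintegral_Ioo_entropyDissipation_le (hb : 0 < b) (hk : 0 < k) (a : Fin n → ℝ) :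
    ∫⁻ s in Set.Ioo 0 τ, ∫⁻ y, ENNReal.ofReal (entropyDissipation b k τ a y s) ≤
      ENNReal.ofReal (k * gaussKernel b a τ) := by
  have hU : Set.Ioo 0 τ ⊆ ⋃ m : ℕ, Set.Ioc (1 / ((m : ℝ) + 1)) (τ - 1 / ((m : ℝ) + 1)) := by
    rintro s ⟨hs0, hsτ⟩
    obtain ⟨m, hm⟩ := exists_nat_one_div_lt (lt_min hs0 (sub_pos.2 hsτ))
    obtain ⟨hm1, hm2⟩ := lt_min_iff.1 hm
    exact Set.mem_iUnion.2 ⟨m, hm1, by linarith⟩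
  refine (lintegral_mono_set hU).trans ?_
  rw [setLIntegral_iUnion_of_directed]
  · refine iSup_le fun m => ?_
    rcases le_total (1 / ((m : ℝ) + 1)) (τ - 1 / ((m : ℝ) + 1)) with h | h
    · have : 0 < 1 / ((m : ℝ) + 1) := by positivity
      exact lintegral_Ioc_entropyDissipation_le hb hk this h (by linarith) a
    · rw [Set.Ioc_eq_empty_of_le h]; simp
  · refine Monotone.directed_le fun m m' hmm => Set.Ioc_subset_Ioc ?_ ?_
    · gcongr
    · gcongr

end EntropyIntegral

section HeatPotential

variable {d : ℕ} {p : ℝ}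

lemma heatBeta_pos (hd : 2 ≤ d) (hp : p ∈ Set.Ioo (0 : ℝ) 1) : 0 < heatBeta d p := by
  have h1 : (2 : ℝ) ≤ d := by exact_mod_cast hd
  have h2 : 0 < 1 - p := sub_pos.2 hp.2
  have h3 : (0 : ℝ) < d - 1 := by linarith
  have h4 := hp.1
  unfold heatBeta
  positivity

lemma heatPhi_of_pos (hd : 2 ≤ d) (x : Fin (d - 1) → ℝ) {t : ℝ} (ht : 0 < t) :
    heatPhi d p x t = gaussKernel (heatBeta d p) x t := by
  unfold heatPhi gaussKernel
  rw [if_pos ht, Nat.cast_sub (by omega), Nat.cast_one]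

lemma heatPhi_of_nonpos (x : Fin (d - 1) → ℝ) {t : ℝ} (ht : t ≤ 0) : heatPhi d p x t = 0 :=
  if_neg ht.not_gt

lemma heatPhi_nonneg (hd : 2 ≤ d) (hp : p ∈ Set.Ioo (0 : ℝ) 1) (x : Fin (d - 1) → ℝ) (t : ℝ) :
    0 ≤ heatPhi d p x t := by
  rcases le_or_gt t 0 with ht | ht
  · exact (heatPhi_of_nonpos x ht).ge
  · rw [heatPhi_of_pos hd x ht]
    exact (gaussKernel_pos (heatBeta_pos hd hp) ht x).le

lemma measurable_heatPhi : Measurable (fun z : Pt d => heatPhi d p z.1 z.2) := by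
  unfold heatPhi
  refine Measurable.ite (measurableSet_lt measurable_const measurable_snd) ?_ measurable_const
  fun_prop

lemma measurable_gaussKernel {n : ℕ} (b : ℝ) :
    Measurable (fun z : (Fin n → ℝ) × ℝ => gaussKernel b z.1 z.2) := by
  unfold gaussKernel
  fun_prop

lemma measurable_entropyDissipation {n : ℕ} (b k τ : ℝ) (a : Fin n → ℝ) :
    Measurable (fun z : (Fin n → ℝ) × ℝ => entropyDissipation b k τ a z.1 z.2) := by
  have h1 := measurable_gaussKernel (n := n) b
  have h2 : Measurable (fun z : (Fin n → ℝ) × ℝ => gaussKernel b (a - z.1) (τ - z.2)) :=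
    h1.comp ((measurable_const.sub measurable_fst).prodMk (measurable_const.sub measurable_snd))
  unfold entropyDissipation
  fun_prop

lemma measurable_heatPhi_sub :
    Measurable (fun q : Pt d × Pt d =>
      heatPhi d p (fun i => q.1.1 i - q.2.1 i) (q.1.2 - q.2.2)) :=
  measurable_heatPhi.comp (measurable_fst.sub measurable_snd)

lemma lintegral_heatPhi_le_one (hd : 2 ≤ d) (hp : p ∈ Set.Ioo (0 : ℝ) 1) (x : Fin (d - 1) → ℝ)
    (t : ℝ) : ∫⁻ y, ENNReal.ofReal (heatPhi d p (x - y) t) ≤ 1 := by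
  rw [lintegral_sub_left_eq_self (fun y => ENNReal.ofReal (heatPhi d p y t))]
  rcases le_or_gt t 0 with ht | ht
  · simp [heatPhi_of_nonpos _ ht]
  · have hb := heatBeta_pos hd hp
    simp_rw [heatPhi_of_pos hd _ ht]
    rw [← ofReal_integral_eq_lintegral_ofReal (integrable_gaussKernel hb ht)
      (ae_of_all _ fun y => (gaussKernel_pos hb ht y).le), integral_gaussKernel hb ht,
      ENNReal.ofReal_one]

lemma integrable_heatPhi_sub_mul (hd : 2 ≤ d) (hp : p ∈ Set.Ioo (0 : ℝ) 1) {f : Pt d → ℝ}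
    (hf : Measurable f) (hbdd : ∃ M, ∀ z, |f z| ≤ M) (hcs : HasCompactSupport f) (z : Pt d) :
    Integrable (fun w : Pt d => heatPhi d p (fun i => z.1 i - w.1 i) (z.2 - w.2) * f w) := by
  obtain ⟨M, hM⟩ := hbdd
  obtain ⟨R, hR⟩ := hcs.isCompact.isBounded.exists_norm_le
  have hΦ : Measurable fun w : Pt d => heatPhi d p (fun i => z.1 i - w.1 i) (z.2 - w.2) :=
    measurable_heatPhi_sub.comp (measurable_const.prodMk measurable_id)
  refine ⟨(hΦ.mul hf).aestronglyMeasurable, ?_⟩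
  have hM0 : 0 ≤ M := (abs_nonneg _).trans (hM z)
  calc ∫⁻ w : Pt d, ‖heatPhi d p (fun i => z.1 i - w.1 i) (z.2 - w.2) * f w‖ₑ
      ≤ ∫⁻ w : Pt d in Set.univ ×ˢ Set.Icc (-R) R, ENNReal.ofReal M *
          ENNReal.ofReal (heatPhi d p (fun i => z.1 i - w.1 i) (z.2 - w.2)) := by
        rw [← lintegral_indicator (MeasurableSet.univ.prod measurableSet_Icc)]
        refine lintegral_mono fun w => ?_
        by_cases hw : f w = 0
        · simp [hw]
        · have h1 : ‖w.2‖ ≤ R := (norm_snd_le w).trans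
            (hR w (subset_tsupport f (Function.mem_support.2 hw)))
          have h2 : w ∈ Set.univ ×ˢ Set.Icc (-R) R := ⟨Set.mem_univ _, abs_le.1 h1⟩
          rw [Set.indicator_of_mem h2, Real.enorm_eq_ofReal_abs,
            ← ENNReal.ofReal_mul hM0, abs_mul, abs_of_nonneg (heatPhi_nonneg hd hp _ _), mul_comm]
          exact ENNReal.ofReal_le_ofReal
            (mul_le_mul_of_nonneg_right (hM w) (heatPhi_nonneg hd hp _ _))
    _ = ENNReal.ofReal M * ∫⁻ s in Set.Icc (-R) R, ∫⁻ y,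
          ENNReal.ofReal (heatPhi d p (z.1 - y) (z.2 - s)) := by
        rw [lintegral_const_mul _ hΦ.ennreal_ofReal, Measure.volume_eq_prod,
          ← Measure.prod_restrict, Measure.restrict_univ,
          lintegral_prod_symm _ hΦ.ennreal_ofReal.aemeasurable]
        rfl
    _ ≤ ENNReal.ofReal M * ∫⁻ s in Set.Icc (-R) R, 1 := by
        gcongr
        exact lintegral_heatPhi_le_one hd hp _ _
    _ < ⊤ := by
        rw [setLIntegral_one]
        exact ENNReal.mul_lt_top ENNReal.ofReal_lt_top (by simp)

lemma heatPhi_mul_le_entropyDissipation (hd : 2 ≤ d) (hp : p ∈ Set.Ioo (0 : ℝ) 1) {r s τ : ℝ}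
    (hr : 0 < r) (hs : 0 < s) (hsτ : s < τ) (a y : Fin (d - 1) → ℝ)
    (h : r ^ (-((d : ℝ) - 1)) ≤ heatPhi d p y s) :
    heatPhi d p (a - y) (τ - s) * (∑ i, y i ^ 2) / s ^ 2 ≤
      4 / heatBeta d p * entropyDissipation (heatBeta d p) (r ^ ((d : ℝ) - 1)) τ a y s := by
  have hb := heatBeta_pos hd hp
  have hk : 0 < r ^ ((d : ℝ) - 1) := Real.rpow_pos_of_pos hr _
  rw [heatPhi_of_pos hd _ hs, Real.rpow_neg hr.le] at h
  rw [heatPhi_of_pos hd _ (sub_pos.2 hsτ)]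
  have hu := gaussKernel_pos hb (sub_pos.2 hsτ) (a - y)
  unfold entropyDissipation
  generalize r ^ ((d : ℝ) - 1) = k at h hk
  have hq : 1 ≤ k * gaussKernel (heatBeta d p) y s := (inv_le_iff_one_le_mul₀' hk).1 h
  generalize k * gaussKernel (heatBeta d p) y s = q at hq
  generalize gaussKernel (heatBeta d p) (a - y) (τ - s) = u at hu
  generalize heatBeta d p = b at hb
  have hq4 : 1 ≤ 4 * (q ^ 2 / (1 + q) ^ 2) := by
    rw [← mul_div_assoc, one_le_div (by positivity)]; nlinarith
  calc u * (∑ i, y i ^ 2) / s ^ 2 ≤ u * (∑ i, y i ^ 2) / s ^ 2 * (4 * (q ^ 2 / (1 + q) ^ 2)) :=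
        le_mul_of_one_le_right (by positivity) hq4
    _ = _ := by field_simp

lemma lintegral_heatBall_zero_le (hd : 2 ≤ d) (hp : p ∈ Set.Ioo (0 : ℝ) 1) {r : ℝ} (hr : 0 < r)
    (a : Fin (d - 1) → ℝ) (τ : ℝ) :
    ∫⁻ z, {z : Pt d | 0 ≤ z.2 ∧ r ^ (-((d : ℝ) - 1)) ≤ heatPhi d p z.1 z.2}.indicator (fun z =>
        ENNReal.ofReal (heatPhi d p (a - z.1) (τ - z.2) * (∑ i, z.1 i ^ 2) / z.2 ^ 2)) z ≤
      ENNReal.ofReal (4 * r ^ ((d : ℝ) - 1) / heatBeta d p * heatPhi d p a τ) := by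
  have hb := heatBeta_pos hd hp
  have hk : 0 < r ^ ((d : ℝ) - 1) := Real.rpow_pos_of_pos hr _
  have hmeas := (measurable_entropyDissipation (heatBeta d p) (r ^ ((d : ℝ) - 1)) τ
    a).ennreal_ofReal
  calc _ ≤ ∫⁻ z : Pt d in Set.univ ×ˢ Set.Ioo 0 τ, ENNReal.ofReal (4 / heatBeta d p) *
        ENNReal.ofReal
          (entropyDissipation (heatBeta d p) (r ^ ((d : ℝ) - 1)) τ a z.1 z.2) := by
        rw [← lintegral_indicator (MeasurableSet.univ.prod measurableSet_Ioo)]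
        refine lintegral_mono fun z => Set.indicator_le (fun z hz => ?_) z
        have hz0 : 0 < z.2 := by
          by_contra hneg
          have h1 := hz.2
          rw [heatPhi_of_nonpos _ (not_lt.1 hneg)] at h1
          exact (Real.rpow_pos_of_pos hr _).not_ge h1
        by_cases hzτ : z.2 < τ
        · have hz' : z ∈ Set.univ ×ˢ Set.Ioo 0 τ := ⟨Set.mem_univ _, hz0, hzτ⟩
          rw [Set.indicator_of_mem hz',
            ← ENNReal.ofReal_mul (by positivity)]
          exact ENNReal.ofReal_le_ofReal
            (heatPhi_mul_le_entropyDissipation hd hp hr hz0 hzτ a z.1 hz.2)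
        · rw [heatPhi_of_nonpos _ (by linarith)]
          simp
    _ = ENNReal.ofReal (4 / heatBeta d p) * ∫⁻ s in Set.Ioo 0 τ, ∫⁻ y, ENNReal.ofReal
          (entropyDissipation (heatBeta d p) (r ^ ((d : ℝ) - 1)) τ a y s) := by
        rw [lintegral_const_mul _ hmeas, Measure.volume_eq_prod, ← Measure.prod_restrict,
          Measure.restrict_univ, lintegral_prod_symm _ hmeas.aemeasurable]
    _ ≤ _ := by
        rcases le_or_gt τ 0 with hτ | hτ
        · simp [Set.Ioo_eq_empty_of_le hτ]
        · refine (mul_le_mul_right (lintegral_Ioo_entropyDissipation_le hb hk a) _).trans_eq ?_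
          rw [heatPhi_of_pos hd _ hτ, ← ENNReal.ofReal_mul (by positivity)]
          congr 1
          ring

lemma measurableSet_heatBallE (x : Fin (d - 1) → ℝ) (t r : ℝ) :
    MeasurableSet (heatBallE d p x t r) :=
  (measurableSet_le measurable_snd measurable_const).inter
    (measurableSet_le measurable_const
      (measurable_heatPhi_sub.comp ((measurable_const (a := (x, t))).prodMk measurable_id)))

lemma lintegral_heatBallE_heatPhi_le (hd : 2 ≤ d) (hp : p ∈ Set.Ioo (0 : ℝ) 1) {r : ℝ}
    (hr : 0 < r) (x : Fin (d - 1) → ℝ) (t : ℝ) (w : Pt d) :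
    ∫⁻ z in heatBallE d p x t r, ENNReal.ofReal
        (heatPhi d p (fun i => z.1 i - w.1 i) (z.2 - w.2) *
          (∑ i, (x i - z.1 i) ^ 2) / (t - z.2) ^ 2) ≤
      ENNReal.ofReal (4 * r ^ ((d : ℝ) - 1) / heatBeta d p *
        heatPhi d p (fun i => x i - w.1 i) (t - w.2)) := by
  refine le_trans (le_of_eq ?_) (lintegral_heatBall_zero_le hd hp hr (x - w.1) (t - w.2))
  rw [← lintegral_indicator (measurableSet_heatBallE x t r)]
  have : (volume : Measure (Pt d)).IsAddLeftInvariant :=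
    inferInstanceAs
      ((volume : Measure (Fin (d - 1) → ℝ)).prod (volume : Measure ℝ)).IsAddLeftInvariant
  have : (volume : Measure (Pt d)).IsNegInvariant :=
    ⟨((Measure.measurePreserving_neg (volume : Measure (Fin (d - 1) → ℝ))).prod
      (Measure.measurePreserving_neg (volume : Measure ℝ))).map_eq⟩
  refine Eq.trans (lintegral_congr fun z => ?_) (lintegral_sub_left_eq_self _ ((x, t) : Pt d))
  by_cases hz : z ∈ heatBallE d p x t r
  · rw [Set.indicator_of_mem hz, Set.indicator_of_mem]
    swap
    · exact ⟨sub_nonneg.2 hz.1, hz.2⟩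
    have e1 : x - w.1 - ((x, t) - z).1 = fun i => z.1 i - w.1 i := by
      ext i; simp
    have e2 : t - w.2 - ((x, t) - z).2 = z.2 - w.2 := by simp
    rw [e1, e2]
    rfl
  · rw [Set.indicator_of_notMem hz, Set.indicator_of_notMem]
    exact fun h => hz ⟨sub_nonneg.1 h.1, h.2⟩

lemma measurable_Gpot {f : Pt d → ℝ} (hf : Measurable f) : Measurable (Gpot d p f) := by
  have h : Measurable (Function.uncurry fun z w : Pt d =>
      heatPhi d p (fun i => z.1 i - w.1 i) (z.2 - w.2) * f w) :=
    measurable_heatPhi_sub.mul (hf.comp measurable_snd)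
  exact (h.stronglyMeasurable.integral_prod_right).measurable.const_mul _

lemma Gpot_nonneg (hd : 2 ≤ d) (hp : p ∈ Set.Ioo (0 : ℝ) 1) {f : Pt d → ℝ} (hnn : ∀ z, 0 ≤ f z)
    (z : Pt d) : 0 ≤ Gpot d p f z :=
  mul_nonneg (one_div_nonneg.2 hp.1.le)
    (integral_nonneg fun _ => mul_nonneg (heatPhi_nonneg hd hp _ _) (hnn _))

lemma ofReal_Gpot (hd : 2 ≤ d) (hp : p ∈ Set.Ioo (0 : ℝ) 1) {f : Pt d → ℝ} (hf : Measurable f)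
    (hnn : ∀ z, 0 ≤ f z) (hbdd : ∃ M, ∀ z, |f z| ≤ M) (hcs : HasCompactSupport f) (z : Pt d) :
    ENNReal.ofReal (Gpot d p f z) = ENNReal.ofReal (1 / p) *
      ∫⁻ w in {w : Pt d | 0 < w.2}, ENNReal.ofReal
        (heatPhi d p (fun i => z.1 i - w.1 i) (z.2 - w.2) * f w) := by
  unfold Gpot
  rw [ENNReal.ofReal_mul (one_div_nonneg.2 hp.1.le), ofReal_integral_eq_lintegral_ofReal
    (integrable_heatPhi_sub_mul hd hp hf hbdd hcs z).integrableOn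
    (ae_of_all _ fun w => mul_nonneg (heatPhi_nonneg hd hp _ _) (hnn w))]

lemma lintegral_heatBallE_Gpot_le (hd : 2 ≤ d) (hp : p ∈ Set.Ioo (0 : ℝ) 1) {f : Pt d → ℝ}
    (hf : Measurable f) (hnn : ∀ z, 0 ≤ f z) (hbdd : ∃ M, ∀ z, |f z| ≤ M)
    (hcs : HasCompactSupport f) (x : Fin (d - 1) → ℝ) (t : ℝ) {r : ℝ} (hr : 0 < r) :
    ∫⁻ z in heatBallE d p x t r, ENNReal.ofReal
        (Gpot d p f z * (∑ i, (x i - z.1 i) ^ 2) / (t - z.2) ^ 2) ≤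
      ENNReal.ofReal (4 * r ^ ((d : ℝ) - 1) / heatBeta d p * Gpot d p f (x, t)) := by
  have hb := heatBeta_pos hd hp
  have hk : 0 < r ^ ((d : ℝ) - 1) := Real.rpow_pos_of_pos hr _
  have hwt : Measurable fun z : Pt d => (∑ i, (x i - z.1 i) ^ 2) / (t - z.2) ^ 2 := by fun_prop
  have hmeas : Measurable (Function.uncurry fun z w : Pt d => ENNReal.ofReal (f w) *
      ENNReal.ofReal (heatPhi d p (fun i => z.1 i - w.1 i) (z.2 - w.2) *
        (∑ i, (x i - z.1 i) ^ 2) / (t - z.2) ^ 2)) := by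
    simp_rw [mul_div_assoc]
    exact (hf.comp measurable_snd).ennreal_ofReal.mul
      (measurable_heatPhi_sub.mul (hwt.comp measurable_fst)).ennreal_ofReal
  calc _ = ∫⁻ z in heatBallE d p x t r, ENNReal.ofReal (1 / p) *
        ∫⁻ w in {w : Pt d | 0 < w.2}, ENNReal.ofReal (f w) *
          ENNReal.ofReal (heatPhi d p (fun i => z.1 i - w.1 i) (z.2 - w.2) *
            (∑ i, (x i - z.1 i) ^ 2) / (t - z.2) ^ 2) := by
        refine lintegral_congr fun z => ?_
        rw [mul_div_assoc, ENNReal.ofReal_mul (Gpot_nonneg hd hp hnn z),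
          ofReal_Gpot hd hp hf hnn hbdd hcs, mul_assoc,
          ← lintegral_mul_const' _ _ ENNReal.ofReal_ne_top]
        congr 1
        refine lintegral_congr fun w => ?_
        rw [← ENNReal.ofReal_mul (mul_nonneg (heatPhi_nonneg hd hp _ _) (hnn w)),
          ← ENNReal.ofReal_mul (hnn w)]
        congr 1
        ring
    _ = ENNReal.ofReal (1 / p) * ∫⁻ w in {w : Pt d | 0 < w.2}, ENNReal.ofReal (f w) *
          ∫⁻ z in heatBallE d p x t r,
            ENNReal.ofReal (heatPhi d p (fun i => z.1 i - w.1 i) (z.2 - w.2) *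
              (∑ i, (x i - z.1 i) ^ 2) / (t - z.2) ^ 2) := by
        rw [lintegral_const_mul' _ _ ENNReal.ofReal_ne_top,
          lintegral_lintegral_swap hmeas.aemeasurable]
        simp_rw [lintegral_const_mul' _ _ ENNReal.ofReal_ne_top]
    _ ≤ ENNReal.ofReal (1 / p) * ∫⁻ w in {w : Pt d | 0 < w.2}, ENNReal.ofReal (f w) *
          ENNReal.ofReal (4 * r ^ ((d : ℝ) - 1) / heatBeta d p *
            heatPhi d p (fun i => x i - w.1 i) (t - w.2)) := by
        gcongr with w
        exact lintegral_heatBallE_heatPhi_le hd hp hr x t w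
    _ = _ := by
        rw [ENNReal.ofReal_mul (by positivity), ofReal_Gpot hd hp hf hnn hbdd hcs,
          mul_left_comm]
        congr 1
        rw [← lintegral_const_mul' _ _ ENNReal.ofReal_ne_top]
        refine lintegral_congr fun w => ?_
        rw [← ENNReal.ofReal_mul (hnn w), ← ENNReal.ofReal_mul (by positivity)]
        congr 1
        ring

end HeatPotential

theorem heat_potential_is_supercaloric
    (d : ℕ) (hd : 2 ≤ d) (p : ℝ) (hp : p ∈ Set.Ioo (0:ℝ) 1)
    (f : Pt d → ℝ) (hf : Measurable f) (hnn : ∀ z, 0 ≤ f z)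
    (hbdd : ∃ M, ∀ z, |f z| ≤ M) (hcs : HasCompactSupport f)
    (hsupp : Function.support f ⊆ {z : Pt d | 0 < z.2}) :
    Supercaloric d p (Gpot d p f) := by
  refine ⟨measurable_Gpot hf, fun x t r hr => ?_⟩
  have hb := heatBeta_pos hd hp
  have hk : 0 < r ^ ((d : ℝ) - 1) := Real.rpow_pos_of_pos hr _
  have hG := Gpot_nonneg hd hp hnn
  have hmeas : Measurable fun z : Pt d =>
      Gpot d p f z * (∑ i, (x i - z.1 i) ^ 2) / (t - z.2) ^ 2 := by
    have := measurable_Gpot (p := p) hf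
    fun_prop
  unfold meanOp
  rw [integral_eq_lintegral_of_nonneg_ae
    (ae_of_all _ fun z => div_nonneg (mul_nonneg (hG z) (by positivity)) (sq_nonneg _))
    hmeas.aestronglyMeasurable]
  have key := ENNReal.toReal_le_of_le_ofReal (mul_nonneg (by positivity) (hG (x, t)))
    (lintegral_heatBallE_Gpot_le hd hp hf hnn hbdd hcs x t hr)
  calc _ ≤ heatBeta d p / (4 * r ^ ((d : ℝ) - 1)) *
        (4 * r ^ ((d : ℝ) - 1) / heatBeta d p * Gpot d p f (x, t)) := by gcongr
    _ = Gpot d p f (x, t) := by field_simp
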